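/- arXiv:2003.01918 — 2 statements merged into one kernel-verified Lean document; each statement's English description precedes it below -/
import Mathlib

section
/- For every natural number n, the number of open Deutsch paths of length n equals T(n,n) − T(n,n−2), where T(n,k) denotes the trinomial coefficient, i.e. the coefficient of X^k in the polynomial (1+X+X²)^n over ℤ (with T(n,k) = 0 for k < 0). -/
/-- A Deutsch path of length `n`: `a 0 = 0` and each step is either an up-step of one
unit or a down-step of arbitrary positive size. -/
def DeutschPath (n : ℕ) (a : Fin (n + 1) → ℕ) : Prop :=
  a 0 = 0 ∧ ∀ j : Fin n, a j.succ = a j.castSucc + 1 ∨ a j.succ < a j.castSucc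

/-- The trinomial coefficient `T(n, k)`: the coefficient of `X^k` in `(1 + X + X²)^n`
over `ℤ`, with `T(n, k) = 0` for `k < 0`. -/
noncomputable def trinomial (n : ℕ) (k : ℤ) : ℤ :=
  if k < 0 then 0
  else ((1 + Polynomial.X + Polynomial.X ^ 2 : Polynomial ℤ) ^ n).coeff k.toNat

open scoped fwdDiff

theorem trinomial_zero (k : ℤ) : trinomial 0 k = if k = 0 then 1 else 0 := by
  unfold trinomial
  simp only [pow_zero, Polynomial.coeff_one]
  grind

theorem trinomial_succ (n : ℕ) (k : ℤ) :
    trinomial (n + 1) k = trinomial n k + trinomial n (k - 1) + trinomial n (k - 2) := by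
  rcases lt_or_ge k 0 with hk | hk
  · simp [trinomial, hk, show k < 1 by lia, show k < 2 by lia]
  · lift k to ℕ using hk
    simp only [trinomial, pow_succ _ n, mul_add, mul_one, Polynomial.coeff_add]
    rcases k with _ | _ | k
    · simp
    · simp [Polynomial.coeff_mul_X_pow', Polynomial.coeff_mul_X]
    · rw [show ((k + 1 + 1 : ℕ) : ℤ) - 1 = (k + 1 : ℕ) by push_cast; ring,
        show ((k + 1 + 1 : ℕ) : ℤ) - 2 = (k : ℕ) by push_cast; ring]
      simp only [Int.toNat_natCast, Polynomial.coeff_mul_X, Polynomial.coeff_mul_X_pow,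
        not_lt.mpr (Int.natCast_nonneg _), if_false]

theorem trinomial_symm (n : ℕ) (k : ℤ) : trinomial n (2 * n - k) = trinomial n k := by
  induction n generalizing k with
  | zero => simp [trinomial_zero]
  | succ n ih =>
    rw [trinomial_succ, trinomial_succ, ← ih k, ← ih (k - 1), ← ih (k - 2)]
    push_cast
    ring_nf

/-- The set of sequences of length `n` with Deutsch steps that start at height `k`. -/
def deutschPathsFrom : (n : ℕ) → ℕ → Finset (Fin (n + 1) → ℕ)
  | 0, k => {fun _ => k}
  | n + 1, k => ((insert (k + 1) (Finset.range k)).biUnion (deutschPathsFrom n)).image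
      (Fin.cons (α := fun _ => ℕ) k)

theorem mem_deutschPathsFrom {n k : ℕ} {a : Fin (n + 1) → ℕ} :
    a ∈ deutschPathsFrom n k ↔
      a 0 = k ∧ ∀ j : Fin n, a j.succ = a j.castSucc + 1 ∨ a j.succ < a j.castSucc := by
  induction n generalizing k with
  | zero =>
    simp only [deutschPathsFrom, Finset.mem_singleton, IsEmpty.forall_iff, and_true]
    refine ⟨fun h => h ▸ rfl, fun h => funext fun i => ?_⟩
    rw [Fin.fin_one_eq_zero i, h]
  | succ n ih =>
    induction a using Fin.consCases with
    | _ x b =>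
    simp only [deutschPathsFrom, Finset.mem_image, Finset.mem_biUnion, Finset.mem_insert,
      Finset.mem_range, ih, Fin.forall_fin_succ, Fin.cons_succ, Fin.castSucc_zero, Fin.cons_zero,
      ← Fin.succ_castSucc, Fin.cons_inj]
    constructor
    · rintro ⟨_, ⟨m, hm, rfl, hc⟩, rfl, rfl⟩
      exact ⟨rfl, hm, hc⟩
    · rintro ⟨rfl, hm, hc⟩
      exact ⟨b, ⟨_, hm, rfl, hc⟩, rfl, rfl⟩

theorem card_deutschPathsFrom_succ (n k : ℕ) :
    (deutschPathsFrom (n + 1) k).card =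
      (deutschPathsFrom n (k + 1)).card + ∑ i ∈ Finset.range k, (deutschPathsFrom n i).card := by
  rw [deutschPathsFrom, Finset.card_image_of_injective _
      (Fin.cons_right_injective (α := fun _ => ℕ) k),
    Finset.card_biUnion, Finset.sum_insert (by simp)]
  intro x _ y _ hxy
  refine Finset.disjoint_left.mpr fun a hx hy => hxy ?_
  rw [← (mem_deutschPathsFrom.mp hx).1, ← (mem_deutschPathsFrom.mp hy).1]

theorem fwdDiff_card_deutschPathsFrom_succ (n : ℕ) :
    Δ_[1] (fun k => ((deutschPathsFrom (n + 1) k).card : ℤ)) =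
      Δ_[1] (Δ_[1] fun k => ((deutschPathsFrom n k).card : ℤ)) +
        Δ_[1] (fun k => ((deutschPathsFrom n k).card : ℤ)) +
        fun k => ((deutschPathsFrom n k).card : ℤ) := by
  funext k
  simp only [fwdDiff, Pi.add_apply, card_deutschPathsFrom_succ, Finset.sum_range_succ]
  push_cast
  ring

theorem fwdDiff_iter_card_deutschPathsFrom_zero (n j : ℕ) :
    ((fwdDiff 1)^[j] fun k => ((deutschPathsFrom n k).card : ℤ)) 0 =
      trinomial n (n - j) - trinomial n (n - j - 2) := by
  induction n generalizing j with
  | zero =>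
    simp only [deutschPathsFrom, Finset.card_singleton, trinomial_zero]
    rcases j with _ | j
    · simp
    · rw [Function.iterate_succ_apply, fwdDiff_const, Function.iterate_fixed (fwdDiff_const 1 0)]
      grind
  | succ n ih =>
    rcases j with _ | j
    · have h0 := ih 0
      have h1 := ih 1
      have hs := trinomial_symm n (n - 1)
      rw [show (2 * n - (n - 1) : ℤ) = n + 1 by ring] at hs
      simp only [Function.iterate_zero, id, Nat.cast_zero, sub_zero] at h0 ⊢
      simp only [Function.iterate_one, fwdDiff, zero_add, Nat.cast_one] at h1
      rw [show (n - 1 - 2 : ℤ) = n - 3 by ring] at h1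
      rw [card_deutschPathsFrom_succ, trinomial_succ, trinomial_succ]
      push_cast
      rw [show (n + 1 - 1 : ℤ) = n by ring, show (n + 1 - 2 : ℤ) = n - 1 by ring,
        show (n - 1 - 1 : ℤ) = n - 2 by ring, show (n - 1 - 2 : ℤ) = n - 3 by ring]
      simp only [Finset.range_zero, Finset.sum_empty]
      linarith
    · have h0 := ih j
      have h1 := ih (j + 1)
      have h2 := ih (j + 2)
      rw [Function.iterate_succ_apply] at h1 h2 ⊢
      rw [Function.iterate_succ_apply] at h2
      rw [fwdDiff_card_deutschPathsFrom_succ, fwdDiff_iter_add, fwdDiff_iter_add,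
        Pi.add_apply, Pi.add_apply, h0, h1, h2, trinomial_succ, trinomial_succ]
      push_cast
      ring_nf

theorem open_deutsch_count (n : ℕ) :
    ({a : Fin (n + 1) → ℕ | DeutschPath n a}.ncard : ℤ) =
      trinomial n n - trinomial n ((n : ℤ) - 2) := by
  have h : {a : Fin (n + 1) → ℕ | DeutschPath n a} = deutschPathsFrom n 0 := by
    ext a
    simp [DeutschPath, mem_deutschPathsFrom]
  rw [h, Set.ncard_coe_finset]
  simpa using fwdDiff_iter_card_deutschPathsFrom_zero n 0
end

section
/- Let K = ℚ(v) be the field of rational functions in one variable v over ℚ, set z = v/(1+v+v²) in K, and for n ≥ 1 let D_n = det(M_n) be the determinant of the n×n Deutsch matrix M_n over K. Then for all n ≥ 1, (1+v+v²)² D_{n+2} − (1+v+v²)(1+v)² D_{n+1} + v(1+v)² D_n = 0. -/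
/-- The rational function `v`. -/
noncomputable def v : RatFunc ℚ := RatFunc.X

/-- `z = v / (1 + v + v²)` in `ℚ(v)`. -/
noncomputable def z : RatFunc ℚ := v / (1 + v + v ^ 2)

/-- The `n × n` Deutsch matrix (1-based indices `i, j`): diagonal entries `1`, entries
`−z` for `j = i − 1` or `j > i`, and `0` for `j < i − 1`.  Here rows and columns are
indexed by `Fin n` (0-based). -/
noncomputable def deutschMatrix (n : ℕ) : Matrix (Fin n) (Fin n) (RatFunc ℚ) :=
  Matrix.of fun i j =>
    if i = j then 1 else if (j : ℕ) + 1 = (i : ℕ) ∨ (i : ℕ) < (j : ℕ) then -z else 0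

/-- `D n` is the determinant of the `n × n` Deutsch matrix. -/
noncomputable def D (n : ℕ) : RatFunc ℚ := (deutschMatrix n).det

theorem deutschMatrix_submatrix_succ (n : ℕ) :
    (deutschMatrix (n + 1)).submatrix Fin.succ Fin.succ = deutschMatrix n := by
  ext i j
  simp [deutschMatrix, Fin.ext_iff]

theorem one_add_v_add_v_sq_ne_zero : (1 + v + v ^ 2 : RatFunc ℚ) ≠ 0 := by
  have h : (1 + Polynomial.X + Polynomial.X ^ 2 : Polynomial ℚ) ≠ 0 := fun h => by
    simpa using congrArg (Polynomial.eval 0) h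
  simpa [v] using RatFunc.algebraMap_ne_zero h

/-- Deleting the first row and the second column of the Deutsch matrix leaves a matrix whose
first column is `(-z, 0, …, 0)`. -/
theorem det_deutschMatrix_submatrix_succ_succAbove_one (n : ℕ) :
    ((deutschMatrix (n + 2)).submatrix Fin.succ (Fin.succAbove 1)).det = -z * D n := by
  rw [Matrix.det_succ_column_zero, Fin.sum_univ_succ, Finset.sum_eq_zero]
  · have h : ((deutschMatrix (n + 2)).submatrix Fin.succ (Fin.succAbove 1)).submatrix
        (Fin.succAbove 0) Fin.succ = deutschMatrix n := by
      ext i j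
      simp [deutschMatrix, Fin.ext_iff]
    rw [h]
    simp [deutschMatrix, D]
  · intro i _
    simp [deutschMatrix, Fin.ext_iff]

/-- Subtracting the second row from the first and expanding along the first row. -/
theorem D_add_two (n : ℕ) : D (n + 2) = (1 + z) * D (n + 1) - z * (1 + z) * D n := by
  have h01 : (0 : Fin (n + 2)) ≠ 1 := by simp
  set A := deutschMatrix (n + 2) with hA
  have hrow_zero : (A 0 + (-1 : RatFunc ℚ) • A 1) 0 = 1 + z := by
    simp [hA, deutschMatrix]
  have hrow_one : (A 0 + (-1 : RatFunc ℚ) • A 1) 1 = -(1 + z) := by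
    simp [hA, deutschMatrix]
  have hrow (j : Fin n) : (A 0 + (-1 : RatFunc ℚ) • A 1) j.succ.succ = 0 := by
    have h : (1 : Fin (n + 2)) < j.succ.succ := by simp [Fin.lt_def, -Fin.val_fin_lt]
    simp [hA, deutschMatrix, Fin.ext_iff, h]
  have hsub (f : Fin (n + 1) → Fin (n + 2)) (r : Fin (n + 2) → RatFunc ℚ) :
      (A.updateRow 0 r).submatrix Fin.succ f = A.submatrix Fin.succ f := by
    ext i j
    simp [Matrix.updateRow_apply]
  have hminor : (A.submatrix Fin.succ (Fin.succAbove 0)).det = D (n + 1) := by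
    rw [Fin.succAbove_zero, hA, deutschMatrix_submatrix_succ, D]
  have hminor_one : (A.submatrix Fin.succ (Fin.succAbove 1)).det = -z * D n :=
    det_deutschMatrix_submatrix_succ_succAbove_one n
  rw [D, ← hA, ← Matrix.det_updateRow_add_smul_self A h01 (-1), Matrix.det_succ_row_zero,
    Fin.sum_univ_succ, Fin.sum_univ_succ]
  simp only [hsub, Matrix.updateRow_self, hrow_zero, hrow_one, hrow, hminor,
    Fin.succ_zero_eq_one, hminor_one]
  simp
  ring

theorem deutsch_det_recursion (n : ℕ) (hn : 1 ≤ n) :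
    (1 + v + v ^ 2) ^ 2 * D (n + 2) - (1 + v + v ^ 2) * (1 + v) ^ 2 * D (n + 1) +
      v * (1 + v) ^ 2 * D n = 0 := by
  have h := one_add_v_add_v_sq_ne_zero
  rw [D_add_two, z]
  field_simp
  ring
end
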